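/- Assume s > 2. Let y_0 = Δ(b) be a Q*_s-unary number with digit sequence b = (b_n). Suppose that for every n, the equation |a_n − α_n| = b_n is solvable for a digit α_n ∈ {0,…,s−1} (i.e., a_n ≥ b_n or a_n + b_n ≤ s−1), and that the set {n : b_n ≠ 0 and a_n ≥ b_n and a_n + b_n ≤ s−1} is infinite. Then the level set L(y_0) = {Δ(α) : α a digit sequence with |a_n − α_n| = b_n for all n} has the cardinality of the continuum. -/

import Mathlib

open Filter Topology MeasureTheory Set

set_option linter.unusedVariables false

/-- β_{k,n} = Σ_{i<k} q_{i,n}. -/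
noncomputable def qbeta (s : ℕ) (q : Fin s → ℕ → ℝ) (k : Fin s) (n : ℕ) : ℝ :=
  ∑ i : Fin s, if i < k then q i n else 0

/-- Δ(α) = β_{α_1,1} + Σ_{n≥2} β_{α_n,n} Π_{j<n} q_{α_j,j}, with positions indexed from 0. -/
noncomputable def Delta (s : ℕ) (q : Fin s → ℕ → ℝ) (α : ℕ → Fin s) : ℝ :=
  ∑' n : ℕ, qbeta s q (α n) n * ∏ j ∈ Finset.range n, q (α j) j

/-- the digit |a − b|. -/
def adiff {s : ℕ} (a b : Fin s) : Fin s :=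
  ⟨a.1 - b.1 + (b.1 - a.1), by have ha := a.2; have hb := b.2; omega⟩

section Monotonicity

variable {s : ℕ} {q : Fin s → ℕ → ℝ}

theorem qbeta_nonneg (hq0 : ∀ i n, 0 < q i n) (k : Fin s) (n : ℕ) : 0 ≤ qbeta s q k n := by
  refine Finset.sum_nonneg fun i _ => ?_
  split_ifs
  exacts [(hq0 i n).le, le_rfl]

theorem qbeta_add_eq_sum (k : Fin s) (n : ℕ) :
    qbeta s q k n + q k n = ∑ i : Fin s, if i ≤ k then q i n else 0 := by
  have h : q k n = ∑ i : Fin s, if i = k then q i n else 0 := by simp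
  rw [qbeta, h, ← Finset.sum_add_distrib]
  refine Finset.sum_congr rfl fun i _ => ?_
  rcases lt_trichotomy i k with hi | rfl | hi
  · simp [hi, hi.ne, hi.le]
  · simp
  · simp [hi.not_gt, hi.ne', hi.not_ge]

theorem qbeta_add_le_one (hq0 : ∀ i n, 0 < q i n) (hqsum : ∀ n, ∑ i : Fin s, q i n = 1)
    (k : Fin s) (n : ℕ) : qbeta s q k n + q k n ≤ 1 := by
  rw [qbeta_add_eq_sum, ← hqsum n]
  refine Finset.sum_le_sum fun i _ => ?_
  split_ifs
  exacts [le_rfl, (hq0 i n).le]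

theorem qbeta_add_lt_qbeta (hq0 : ∀ i n, 0 < q i n) {k l : Fin s} (hkl : k.1 + 2 ≤ l.1)
    (n : ℕ) : qbeta s q k n + q k n < qbeta s q l n := by
  rw [qbeta_add_eq_sum, qbeta]
  refine Finset.sum_lt_sum (fun i _ => ?_)
    ⟨⟨k.1 + 1, by omega⟩, Finset.mem_univ _, ?_⟩
  · by_cases hi : i ≤ k
    · have hl : i < l := by
        rw [Fin.le_def] at hi
        rw [Fin.lt_def]
        omega
      simp [hi, hl]
    · rw [if_neg hi]
      split_ifs
      exacts [(hq0 i n).le, le_rfl]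
  · have h1 : ¬ (⟨k.1 + 1, by omega⟩ : Fin s) ≤ k := by
      rw [Fin.le_def]
      simp
    have h2 : (⟨k.1 + 1, by omega⟩ : Fin s) < l := by
      rw [Fin.lt_def]
      exact hkl
    rw [if_neg h1, if_pos h2]
    exact hq0 _ n

/-- The right endpoints of the cylinders containing `Δ(α)` decrease with the rank. -/
theorem antitone_cylinder_right (hq0 : ∀ i n, 0 < q i n)
    (hqsum : ∀ n, ∑ i : Fin s, q i n = 1) (α : ℕ → Fin s) :
    Antitone fun N => ∑ n ∈ Finset.range N, qbeta s q (α n) n * ∏ j ∈ Finset.range n, q (α j) j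
      + ∏ j ∈ Finset.range N, q (α j) j := by
  refine antitone_nat_of_succ_le fun N => ?_
  simp only [Finset.sum_range_succ, Finset.prod_range_succ]
  have hP : 0 ≤ ∏ j ∈ Finset.range N, q (α j) j := Finset.prod_nonneg fun j _ => (hq0 _ j).le
  nlinarith [mul_le_mul_of_nonneg_right (qbeta_add_le_one hq0 hqsum (α N) N) hP]

theorem Delta_term_nonneg (hq0 : ∀ i n, 0 < q i n) (α : ℕ → Fin s) (n : ℕ) :
    0 ≤ qbeta s q (α n) n * ∏ j ∈ Finset.range n, q (α j) j :=
  mul_nonneg (qbeta_nonneg hq0 _ _) (Finset.prod_nonneg fun j _ => (hq0 _ j).le)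

theorem summable_Delta (hq0 : ∀ i n, 0 < q i n) (hqsum : ∀ n, ∑ i : Fin s, q i n = 1)
    (α : ℕ → Fin s) :
    Summable fun n => qbeta s q (α n) n * ∏ j ∈ Finset.range n, q (α j) j := by
  refine summable_of_sum_range_le (c := 1) (Delta_term_nonneg hq0 α) fun N => ?_
  have h := antitone_cylinder_right hq0 hqsum α (Nat.zero_le N)
  have hP : 0 ≤ ∏ j ∈ Finset.range N, q (α j) j := Finset.prod_nonneg fun j _ => (hq0 _ j).le
  simp only [Finset.range_zero, Finset.sum_empty, Finset.prod_empty] at h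
  linarith

theorem sum_range_le_Delta (hq0 : ∀ i n, 0 < q i n) (hqsum : ∀ n, ∑ i : Fin s, q i n = 1)
    (α : ℕ → Fin s) (N : ℕ) :
    ∑ n ∈ Finset.range N, qbeta s q (α n) n * ∏ j ∈ Finset.range n, q (α j) j ≤ Delta s q α :=
  (summable_Delta hq0 hqsum α).sum_le_tsum _ fun n _ => Delta_term_nonneg hq0 α n

theorem Delta_le_cylinder_right (hq0 : ∀ i n, 0 < q i n)
    (hqsum : ∀ n, ∑ i : Fin s, q i n = 1) (α : ℕ → Fin s) (N : ℕ) :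
    Delta s q α ≤ ∑ n ∈ Finset.range N, qbeta s q (α n) n * ∏ j ∈ Finset.range n, q (α j) j
      + ∏ j ∈ Finset.range N, q (α j) j := by
  refine le_of_tendsto (summable_Delta hq0 hqsum α).hasSum.tendsto_sum_nat ?_
  filter_upwards [eventually_ge_atTop N] with M hM
  have h := antitone_cylinder_right hq0 hqsum α hM
  have hP : 0 ≤ ∏ j ∈ Finset.range M, q (α j) j := Finset.prod_nonneg fun j _ => (hq0 _ j).le
  simp only at h
  linarith

/-- Sequences whose first differing digits are not adjacent represent different numbers. -/
theorem Delta_lt_Delta (hq0 : ∀ i n, 0 < q i n) (hqsum : ∀ n, ∑ i : Fin s, q i n = 1)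
    {α γ : ℕ → Fin s} {N : ℕ} (heq : ∀ n < N, α n = γ n) (hN : (α N).1 + 2 ≤ (γ N).1) :
    Delta s q α < Delta s q γ := by
  have h1 := Delta_le_cylinder_right hq0 hqsum α (N + 1)
  have h2 := sum_range_le_Delta hq0 hqsum γ (N + 1)
  have hprod : ∀ n ≤ N, ∏ j ∈ Finset.range n, q (α j) j = ∏ j ∈ Finset.range n, q (γ j) j :=
    fun n hn => Finset.prod_congr rfl fun j hj => by
      rw [heq j ((Finset.mem_range.1 hj).trans_le hn)]
  have hsum : ∑ n ∈ Finset.range N, qbeta s q (α n) n * ∏ j ∈ Finset.range n, q (α j) j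
      = ∑ n ∈ Finset.range N, qbeta s q (γ n) n * ∏ j ∈ Finset.range n, q (γ j) j :=
    Finset.sum_congr rfl fun n hn => by
      rw [heq n (Finset.mem_range.1 hn), hprod n (Finset.mem_range.1 hn).le]
  have hP : 0 < ∏ j ∈ Finset.range N, q (γ j) j := Finset.prod_pos fun j _ => hq0 _ j
  rw [Finset.sum_range_succ, Finset.prod_range_succ, hsum, hprod N le_rfl] at h1
  rw [Finset.sum_range_succ] at h2
  nlinarith [mul_lt_mul_of_pos_right (qbeta_add_lt_qbeta hq0 hN N) hP]

end Monotonicity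

/-- If two non-adjacent digits may be chosen freely at infinitely many positions, then the
represented numbers form a set of the cardinality of the continuum. -/
theorem continuum_le_mk_of_free_digits {s : ℕ} {q : Fin s → ℕ → ℝ} (hq0 : ∀ i n, 0 < q i n)
    (hqsum : ∀ n, ∑ i : Fin s, q i n = 1) {S : Set ℕ} (hS : S.Infinite)
    {D : ℕ → Set (Fin s)} {lo hi : ℕ → Fin s} (hlo : ∀ n, lo n ∈ D n) (hhi : ∀ n, hi n ∈ D n)
    (hgap : ∀ n ∈ S, (lo n).1 + 2 ≤ (hi n).1) :
    Cardinal.continuum ≤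
      Cardinal.mk ↥{x : ℝ | ∃ α : ℕ → Fin s, (∀ n, α n ∈ D n) ∧ x = Delta s q α} := by
  classical
  let F : Set S → ℕ → Fin s := fun T n => if n ∈ Subtype.val '' T then hi n else lo n
  have hF : ∀ T n, F T n ∈ D n := fun T n => by
    dsimp only [F]
    split_ifs
    exacts [hhi n, hlo n]
  have hFinj : Function.Injective fun T => Delta s q (F T) := by
    intro T U hTU
    by_contra hne
    have hex : ∃ n, ¬ (n ∈ Subtype.val '' T ↔ n ∈ Subtype.val '' U) := by
      by_contra! h
      exact hne (Subtype.val_injective.image_injective (Set.ext h))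
    have hmin : ∀ m < Nat.find hex, F T m = F U m := fun m hm => by
      have h := not_not.1 (Nat.find_min hex hm)
      simp only [F, h]
    have hspec := Nat.find_spec hex
    generalize Nat.find hex = n at hmin hspec
    by_cases hT : n ∈ Subtype.val '' T
    · have hU : n ∉ Subtype.val '' U := fun hU => hspec (iff_of_true hT hU)
      obtain ⟨x, -, hx⟩ := id hT
      refine (Delta_lt_Delta hq0 hqsum (fun m hm => (hmin m hm).symm) ?_).ne' hTU
      simp only [F, if_pos hT, if_neg hU]
      exact hgap n (hx ▸ x.2)
    · have hU : n ∈ Subtype.val '' U := by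
        by_contra hU
        exact hspec (iff_of_false hT hU)
      obtain ⟨x, -, hx⟩ := id hU
      refine (Delta_lt_Delta hq0 hqsum hmin ?_).ne hTU
      simp only [F, if_neg hT, if_pos hU]
      exact hgap n (hx ▸ x.2)
  have : Infinite S := hS.to_subtype
  calc Cardinal.continuum = Cardinal.mk (Set S) := by
        rw [Cardinal.mk_set, Cardinal.mk_eq_aleph0 S, Cardinal.two_power_aleph0]
    _ ≤ _ := Cardinal.mk_le_of_injective
        (f := fun T => ⟨Delta s q (F T), F T, hF T, rfl⟩)
        fun T U h => hFinj (congrArg Subtype.val h)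

/-- s > 2; if |a_n − α_n| = b_n is solvable in digits for every n, and
b_n ≠ 0 with both solutions admissible for infinitely many n, then the level set L(y₀)
of the unary point y₀ = Δ(b) has the cardinality of the continuum. -/
theorem stmt19 (s : ℕ) (hs : 2 ≤ s) (q : Fin s → ℕ → ℝ)
    (hq0 : ∀ i n, 0 < q i n) (hq1 : ∀ i n, q i n < 1)
    (hqsum : ∀ n, ∑ i : Fin s, q i n = 1)
    (hqprod : Filter.Tendsto (fun N => ∏ n ∈ Finset.range N, ⨆ i : Fin s, q i n)
      Filter.atTop (nhds 0))
    (hs' : 2 < s)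
    (a : ℝ) (ha : a ∈ Set.Icc (0 : ℝ) 1) (aseq : ℕ → Fin s)
    (haseq : a = ∑' n : ℕ, (aseq n : ℝ) / (s : ℝ) ^ (n + 1))
    (b : ℕ → Fin s)
    (hbunary : ∀ γ : ℕ → Fin s, Delta s q γ = Delta s q b → γ = b)
    (hsolv : ∀ n, (b n).1 ≤ (aseq n).1 ∨ (aseq n).1 + (b n).1 ≤ s - 1)
    (hinf : {n : ℕ | (b n).1 ≠ 0 ∧ (b n).1 ≤ (aseq n).1 ∧
        (aseq n).1 + (b n).1 ≤ s - 1}.Infinite) :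
    Cardinal.mk
        ↥{x : ℝ | ∃ α : ℕ → Fin s, (∀ n, adiff (aseq n) (α n) = b n) ∧
          x = Delta s q α} = Cardinal.continuum := by
  refine le_antisymm ((Cardinal.mk_set_le _).trans Cardinal.mk_real.le) ?_
  have hdigits : ∀ n, ∃ lo hi : Fin s, adiff (aseq n) lo = b n ∧ adiff (aseq n) hi = b n ∧
      (((b n).1 ≠ 0 ∧ (b n).1 ≤ (aseq n).1 ∧ (aseq n).1 + (b n).1 ≤ s - 1) →
        lo.1 + 2 ≤ hi.1) := by
    intro n
    have han := (aseq n).2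
    by_cases h1 : (b n).1 ≤ (aseq n).1
    · have hlo : adiff (aseq n) ⟨(aseq n).1 - (b n).1, by omega⟩ = b n := by
        ext
        simp only [adiff]
        omega
      by_cases h2 : (aseq n).1 + (b n).1 ≤ s - 1
      · refine ⟨⟨(aseq n).1 - (b n).1, by omega⟩, ⟨(aseq n).1 + (b n).1, by omega⟩,
          hlo, ?_, fun h => ?_⟩
        · ext
          simp only [adiff]
          omega
        · simp only
          omega
      · exact ⟨_, _, hlo, hlo, fun h => absurd h.2.2 h2⟩
    · have h2 := (hsolv n).resolve_left h1
      have hhi : adiff (aseq n) ⟨(aseq n).1 + (b n).1, by omega⟩ = b n := by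
        ext
        simp only [adiff]
        omega
      exact ⟨_, _, hhi, hhi, fun h => absurd h.2.1 h1⟩
  choose lo hi hlo hhi hgap using hdigits
  exact continuum_le_mk_of_free_digits hq0 hqsum hinf
    (D := fun n => {d | adiff (aseq n) d = b n}) hlo hhi hgap
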